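/- arXiv:1105.6077 — 6 statements merged into one kernel-verified Lean document; each statement's English description precedes it below -/
import Mathlib

section
/- For every α > 0, β ≥ 1 and every integer k ≥ 1, ∫₀¹ s^k · φ_{α,β}″(s) φ_{α,β}(s) / (φ_{α,β}′(s))² ds = ((k+1)β + αβ − k) / ((k+1)²β + (k+1)αβ); that is, the k-th copula moment of the transformed Gumbel copula equals M_k(α,β) = ((k+1)β + αβ − k)/((k+1)²β + (k+1)αβ). -/
lemma rpow_neg_sub_one_pos {α s : ℝ} (hα : 0 < α) (hs : s ∈ Set.Ioo (0 : ℝ) 1) :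
    0 < s ^ (-α) - 1 :=
  sub_pos.2 (Real.one_lt_rpow_of_pos_of_lt_one_of_neg hs.1 hs.2 (neg_lt_zero.2 hα))

lemma hasDerivAt_rpow_neg_sub_one_rpow {α s : ℝ} (β : ℝ) (hα : 0 < α)
    (hs : s ∈ Set.Ioo (0 : ℝ) 1) :
    HasDerivAt (fun t : ℝ => (t ^ (-α) - 1) ^ β)
      (-α * s ^ (-α - 1) * β * (s ^ (-α) - 1) ^ (β - 1)) s :=
  ((Real.hasDerivAt_rpow_const (Or.inl hs.1.ne')).sub_const 1).rpow_const
    (Or.inl (rpow_neg_sub_one_pos hα hs).ne')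

/-- The Kendall density of the transformed Gumbel copula, in closed form. -/
lemma deriv_deriv_mul_div_deriv_sq {α β s : ℝ} (hα : 0 < α) (hβ : 0 < β)
    (hs : s ∈ Set.Ioo (0 : ℝ) 1) {φ : ℝ → ℝ} (hφ : ∀ t : ℝ, φ t = (t ^ (-α) - 1) ^ β) :
    deriv (deriv φ) s * φ s / (deriv φ s) ^ 2 =
      (β - 1) / β + (α + 1) / (α * β) * (1 - s ^ α) := by
  obtain rfl : φ = fun t : ℝ => (t ^ (-α) - 1) ^ β := funext hφ
  have hderiv : ∀ t ∈ Set.Ioo (0 : ℝ) 1, deriv (fun t : ℝ => (t ^ (-α) - 1) ^ β) t =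
      -α * t ^ (-α - 1) * β * (t ^ (-α) - 1) ^ (β - 1) := fun t ht =>
    (hasDerivAt_rpow_neg_sub_one_rpow β hα ht).deriv
  have hderiv2 := ((((Real.hasDerivAt_rpow_const (p := -α - 1)
    (Or.inl hs.1.ne')).const_mul (-α)).mul_const β).mul
    (hasDerivAt_rpow_neg_sub_one_rpow (β - 1) hα hs)).congr_of_eventuallyEq
    (Filter.eventually_of_mem (isOpen_Ioo.mem_nhds hs) hderiv)
  rw [hderiv2.deriv, hderiv s hs]
  have hg := rpow_neg_sub_one_pos hα hs
  have hs0 : s ≠ 0 := hs.1.ne'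
  have hsα : 0 < s ^ α := Real.rpow_pos_of_pos hs.1 α
  simp only [Real.rpow_sub_one hg.ne', Real.rpow_sub_one hs0]
  set g := s ^ (-α) - 1 with hg_def
  have hgs : g * s ^ α = 1 - s ^ α := by
    rw [hg_def, Real.rpow_neg hs.1.le]
    field_simp
  have hsg : s ^ (-α) = (s ^ α)⁻¹ := Real.rpow_neg hs.1.le α
  have hP : 0 < g ^ β := Real.rpow_pos_of_pos hg β
  rw [← hgs, hsg]
  field_simp
  ring

theorem stmt_9 (α β : ℝ) (hα : 0 < α) (hβ : 1 ≤ β) (k : ℕ) (hk : 1 ≤ k)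
    (φ : ℝ → ℝ) (hφ : ∀ t : ℝ, φ t = (t ^ (-α) - 1) ^ β) :
    ∫ s in Set.Ioo (0 : ℝ) 1,
        s ^ k * (deriv (deriv φ) s * φ s / (deriv φ s) ^ 2) =
      ((k + 1 : ℝ) * β + α * β - k) /
        ((k + 1 : ℝ) ^ 2 * β + (k + 1 : ℝ) * α * β) := by
  have hβ0 : 0 < β := by linarith
  have hk0 : (0 : ℝ) ≤ k := k.cast_nonneg
  have hkα : -1 < (k : ℝ) + α := by linarith
  have hcongr : Set.EqOn
      (fun s : ℝ => s ^ k * (deriv (deriv φ) s * φ s / (deriv φ s) ^ 2))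
      (fun s : ℝ => ((β - 1) / β + (α + 1) / (α * β)) * s ^ k -
        (α + 1) / (α * β) * s ^ ((k : ℝ) + α)) (Set.Ioo 0 1) := by
    intro s hs
    simp only [deriv_deriv_mul_div_deriv_sq hα hβ0 hs hφ, Real.rpow_add hs.1, Real.rpow_natCast]
    ring
  rw [MeasureTheory.setIntegral_congr_fun measurableSet_Ioo hcongr,
    ← MeasureTheory.integral_Ioc_eq_integral_Ioo,
    ← intervalIntegral.integral_of_le zero_le_one,
    intervalIntegral.integral_sub
      ((intervalIntegral.intervalIntegrable_pow k).const_mul _)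
      ((intervalIntegral.intervalIntegrable_rpow' hkα).const_mul _),
    intervalIntegral.integral_const_mul, intervalIntegral.integral_const_mul, integral_pow,
    integral_rpow (Or.inl hkα), Real.one_rpow, Real.zero_rpow (by linarith)]
  have h1 : (k : ℝ) + 1 ≠ 0 := by positivity
  have h2 : (k : ℝ) + α + 1 ≠ 0 := by positivity
  have h3 : ((k : ℝ) + 1) ^ 2 * β + (k + 1) * α * β ≠ 0 := by positivity
  simp only [one_pow, zero_pow k.succ_ne_zero, sub_zero]
  field_simp
  ring
end

section
/- Let μ be a probability measure on [0,1]² whose cumulative distribution function is C_{α,β}, i.e. μ([0,u]×[0,v]) = C_{α,β}(u,v) for all (u,v) ∈ [0,1]². Then the pushforward of μ under the map (u,v) ↦ C_{α,β}(u,v) has cumulative distribution function K_{α,β}(s) = s + (s − s^{α+1})/(αβ) on [0,1]; i.e., μ({(u,v) ∈ [0,1]² : C_{α,β}(u,v) ≤ s}) = s + (s − s^{α+1})/(αβ) for all s ∈ [0,1]. -/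
open MeasureTheory

open Filter Topology

/-- `ψ` is a strictly decreasing bijection from `[0, ∞)` onto `(0, 1]` with inverse `φ`. -/
structure IsArchimedeanPair (φ ψ : ℝ → ℝ) : Prop where
  strictAntiOn : StrictAntiOn ψ (Set.Ici 0)
  map_mem : ∀ t, 0 ≤ t → ψ t ∈ Set.Ioc (0 : ℝ) 1
  map_zero : ψ 0 = 1
  left_inv : ∀ t, 0 ≤ t → φ (ψ t) = t
  inv_nonneg : ∀ u ∈ Set.Ioc (0 : ℝ) 1, 0 ≤ φ u
  right_inv : ∀ u ∈ Set.Ioc (0 : ℝ) 1, ψ (φ u) = u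

namespace IsArchimedeanPair

variable {φ ψ : ℝ → ℝ}

theorem le_iff (h : IsArchimedeanPair φ ψ) {a b : ℝ} (ha : 0 ≤ a) (hb : 0 ≤ b) :
    ψ a ≤ ψ b ↔ b ≤ a :=
  h.strictAntiOn.le_iff_ge ha hb

theorem lt_iff (h : IsArchimedeanPair φ ψ) {a b : ℝ} (ha : 0 ≤ a) (hb : 0 ≤ b) :
    ψ a < ψ b ↔ b < a :=
  h.strictAntiOn.lt_iff_gt ha hb

theorem measureReal_strip (h : IsArchimedeanPair φ ψ) {μ : Measure (ℝ × ℝ)} [IsFiniteMeasure μ]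
    (hμ : ∀ a b : ℝ, 0 ≤ a → 0 ≤ b →
      μ.real (Set.Icc 0 (ψ a) ×ˢ Set.Icc 0 (ψ b)) = ψ (a + b))
    {a δ b : ℝ} (ha : 0 ≤ a) (hδ : 0 ≤ δ) (hb : 0 ≤ b) :
    μ.real (Set.Ioc (ψ (a + δ)) (ψ a) ×ˢ Set.Icc 0 (ψ b)) = ψ (a + b) - ψ (a + δ + b) := by
  have hpos := (h.map_mem (a + δ) (by positivity)).1
  have hle : ψ (a + δ) ≤ ψ a := (h.le_iff (by positivity) ha).2 (by linarith)
  have hdiff : Set.Ioc (ψ (a + δ)) (ψ a) ×ˢ Set.Icc 0 (ψ b) =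
      (Set.Icc 0 (ψ a) ×ˢ Set.Icc 0 (ψ b)) \ (Set.Icc 0 (ψ (a + δ)) ×ˢ Set.Icc 0 (ψ b)) := by
    ext ⟨x, y⟩
    simp only [Set.mem_prod, Set.mem_Ioc, Set.mem_Icc, Set.mem_sdiff]
    grind
  rw [hdiff, measureReal_sdiff (Set.prod_mono_left (Set.Icc_subset_Icc_right hle))
    (measurableSet_Icc.prod measurableSet_Icc), hμ a b ha hb, hμ _ b (by positivity) hb]

theorem measureReal_left_strip (h : IsArchimedeanPair φ ψ) {μ : Measure (ℝ × ℝ)}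
    (hμ : ∀ a b : ℝ, 0 ≤ a → 0 ≤ b →
      μ.real (Set.Icc 0 (ψ a) ×ˢ Set.Icc 0 (ψ b)) = ψ (a + b))
    {t : ℝ} (ht : 0 ≤ t) :
    μ.real (Set.Icc 0 (ψ t) ×ˢ Set.Icc 0 1) = ψ t := by
  simpa [h.map_zero] using hμ t 0 ht le_rfl

variable {C : ℝ → ℝ → ℝ}

theorem strips_subset_sublevel (h : IsArchimedeanPair φ ψ)
    (hC : ∀ u ∈ Set.Ioc (0 : ℝ) 1, ∀ v ∈ Set.Ioc (0 : ℝ) 1, C u v = ψ (φ u + φ v))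
    (hC0 : ∀ u v : ℝ, u = 0 ∨ v = 0 → C u v = 0) {δ : ℝ} (hδ : 0 < δ) (n : ℕ) :
    (Set.Icc 0 (ψ (n * δ)) ×ˢ Set.Icc 0 1) ∪
      (⋃ k ∈ Finset.range n,
        Set.Ioc (ψ (k * δ + δ)) (ψ (k * δ)) ×ˢ Set.Icc 0 (ψ (n * δ - k * δ))) ⊆
    {p : ℝ × ℝ | p.1 ∈ Set.Icc (0 : ℝ) 1 ∧ p.2 ∈ Set.Icc (0 : ℝ) 1 ∧
      C p.1 p.2 ≤ ψ (n * δ)} := by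
  have hn : 0 ≤ n * δ := by positivity
  have hs := h.map_mem _ hn
  rintro ⟨u, v⟩ hp
  have key : ∀ c, 0 ≤ c → c ≤ n * δ → 0 ≤ u → u ≤ ψ c → 0 ≤ v → v ≤ ψ (n * δ - c) →
      C u v ≤ ψ (n * δ) := by
    intro c hc hcn hu huc hv hvc
    rcases hu.eq_or_lt with rfl | hu
    · rw [hC0 _ _ (Or.inl rfl)]; exact hs.1.le
    rcases hv.eq_or_lt with rfl | hv
    · rw [hC0 _ _ (Or.inr rfl)]; exact hs.1.le
    have hu1 : u ∈ Set.Ioc (0 : ℝ) 1 := ⟨hu, huc.trans (h.map_mem c hc).2⟩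
    have hv1 : v ∈ Set.Ioc (0 : ℝ) 1 := ⟨hv, hvc.trans (h.map_mem _ (by linarith)).2⟩
    have hφu := h.inv_nonneg u hu1
    have hφv := h.inv_nonneg v hv1
    rw [← h.right_inv u hu1, h.le_iff hφu hc] at huc
    rw [← h.right_inv v hv1, h.le_iff hφv (by linarith)] at hvc
    rw [hC u hu1 v hv1, h.le_iff (by positivity) hn]
    linarith
  rcases hp with ⟨⟨hu0, hu1⟩, hv0, hv1⟩ | hp
  · refine ⟨⟨hu0, hu1.trans hs.2⟩, ⟨hv0, hv1⟩, key (n * δ) hn le_rfl hu0 hu1 hv0 ?_⟩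
    simpa [h.map_zero] using hv1
  · simp only [Set.mem_iUnion, Finset.mem_range] at hp
    obtain ⟨k, hk, ⟨hu0, hu1⟩, hv0, hv1⟩ := hp
    have hkδ : 0 ≤ k * δ := by positivity
    have hkn : k * δ ≤ n * δ := by gcongr
    have hu0 := (h.map_mem (k * δ + δ) (by positivity)).1.le.trans hu0.le
    exact ⟨⟨hu0, hu1.trans (h.map_mem _ hkδ).2⟩,
      ⟨hv0, hv1.trans (h.map_mem _ (by linarith)).2⟩, key _ hkδ hkn hu0 hu1 hv0 hv1⟩

theorem sublevel_subset_strips (h : IsArchimedeanPair φ ψ)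
    (hC : ∀ u ∈ Set.Ioc (0 : ℝ) 1, ∀ v ∈ Set.Ioc (0 : ℝ) 1, C u v = ψ (φ u + φ v))
    {δ : ℝ} (hδ : 0 < δ) (n : ℕ) :
    {p : ℝ × ℝ | p.1 ∈ Set.Icc (0 : ℝ) 1 ∧ p.2 ∈ Set.Icc (0 : ℝ) 1 ∧
      C p.1 p.2 ≤ ψ (n * δ)} ⊆
    (Set.Icc 0 (ψ (n * δ)) ×ˢ Set.Icc 0 1) ∪
      (⋃ k ∈ Finset.range n,
        Set.Ioc (ψ (k * δ + δ)) (ψ (k * δ)) ×ˢ Set.Icc 0 (ψ (n * δ - (k * δ + δ)))) := by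
  have hn : 0 ≤ n * δ := by positivity
  rintro ⟨u, v⟩ ⟨⟨hu0, hu1⟩, ⟨hv0, hv1⟩, hle⟩
  dsimp only at hu0 hu1 hv0 hv1 hle
  rcases le_or_gt u (ψ (n * δ)) with hus | hus
  · exact Or.inl ⟨⟨hu0, hus⟩, hv0, hv1⟩
  right
  have hu : u ∈ Set.Ioc (0 : ℝ) 1 := ⟨(h.map_mem _ hn).1.trans hus, hu1⟩
  have hφu := h.inv_nonneg u hu
  have hφn : φ u < n * δ := by
    rwa [← h.right_inv u hu, h.lt_iff hn hφu] at hus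
  set k := ⌊φ u / δ⌋₊ with hk
  have hkl : k * δ ≤ φ u := (le_div_iff₀ hδ).1 (Nat.floor_le (by positivity))
  have hku : φ u < k * δ + δ := by
    have := (div_lt_iff₀ hδ).1 (Nat.lt_floor_add_one (φ u / δ))
    rw [← hk] at this
    linarith
  have hkn : k < n := (Nat.floor_lt (by positivity)).2 ((div_lt_iff₀ hδ).2 hφn)
  have hkn' : k * δ + δ ≤ n * δ := by
    have : (k : ℝ) + 1 ≤ n := by exact_mod_cast hkn
    nlinarith
  have hkδ : 0 ≤ k * δ := by positivity
  simp only [Set.mem_iUnion, Finset.mem_range]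
  refine ⟨k, hkn, ⟨?_, ?_⟩, hv0, ?_⟩
  · change _ < u
    rwa [← h.right_inv u hu, h.lt_iff (by positivity) hφu]
  · change u ≤ _
    rwa [← h.right_inv u hu, h.le_iff hφu hkδ]
  · change v ≤ _
    rcases hv0.eq_or_lt with rfl | hv0
    · exact (h.map_mem _ (by linarith)).1.le
    have hv : v ∈ Set.Ioc (0 : ℝ) 1 := ⟨hv0, hv1⟩
    have hφv := h.inv_nonneg v hv
    rw [hC u hu v hv, h.le_iff (by positivity) hn] at hle
    rw [← h.right_inv v hv, h.le_iff hφv (by linarith)]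
    linarith

theorem le_measureReal_sublevel (h : IsArchimedeanPair φ ψ)
    (hC : ∀ u ∈ Set.Ioc (0 : ℝ) 1, ∀ v ∈ Set.Ioc (0 : ℝ) 1, C u v = ψ (φ u + φ v))
    (hC0 : ∀ u v : ℝ, u = 0 ∨ v = 0 → C u v = 0)
    {μ : Measure (ℝ × ℝ)} [IsFiniteMeasure μ]
    (hμ : ∀ a b : ℝ, 0 ≤ a → 0 ≤ b →
      μ.real (Set.Icc 0 (ψ a) ×ˢ Set.Icc 0 (ψ b)) = ψ (a + b))
    {δ : ℝ} (hδ : 0 < δ) (n : ℕ) :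
    ψ (n * δ) + n * (ψ (n * δ) - ψ (n * δ + δ)) ≤
      μ.real {p : ℝ × ℝ | p.1 ∈ Set.Icc (0 : ℝ) 1 ∧ p.2 ∈ Set.Icc (0 : ℝ) 1 ∧
        C p.1 p.2 ≤ ψ (n * δ)} := by
  refine le_trans (le_of_eq ?_) (measureReal_mono (h.strips_subset_sublevel hC hC0 hδ n))
  have hn : 0 ≤ n * δ := by positivity
  have hanti : Antitone fun k : ℕ => ψ (k * δ) := by
    intro i j hij
    exact (h.le_iff (by positivity) (by positivity)).2 (by gcongr)
  have hmeas : ∀ k ∈ Finset.range n, MeasurableSet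
      (Set.Ioc (ψ (k * δ + δ)) (ψ (k * δ)) ×ˢ Set.Icc 0 (ψ (n * δ - k * δ))) :=
    fun k _ => measurableSet_Ioc.prod measurableSet_Icc
  rw [measureReal_union _ (Finset.measurableSet_biUnion _ hmeas)
      (measure_ne_top _ _) (measure_ne_top _ _),
    measureReal_biUnion_finset _ hmeas, h.measureReal_left_strip hμ hn]
  · congr 1
    rw [Finset.sum_congr rfl (g := fun _ => ψ (n * δ) - ψ (n * δ + δ))]
    · simp [mul_sub]
    · intro k hk
      have hkn : k * δ ≤ n * δ := by
        have := (Finset.mem_range.1 hk).le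
        gcongr
      rw [h.measureReal_strip hμ (by positivity) hδ.le (by linarith)]
      congr 2 <;> ring
  · intro i _ j _ hij
    have := hanti.pairwise_disjoint_on_Ioc_succ hij
    refine Set.Disjoint.set_prod_left ?_ _ _
    simpa [Function.onFun, add_mul] using this
  · rw [Set.disjoint_iUnion₂_right]
    intro k hk
    refine Set.Disjoint.set_prod_left (Set.disjoint_left.2 fun x hx hx' => ?_) _ _
    have := hanti (Nat.succ_le_of_lt (Finset.mem_range.1 hk))
    have hsucc : ((k.succ : ℕ) : ℝ) * δ = k * δ + δ := by push_cast; ring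
    simp only [hsucc] at this
    exact absurd (hx'.1.trans_le hx.2) this.not_gt

theorem measureReal_sublevel_le (h : IsArchimedeanPair φ ψ)
    (hC : ∀ u ∈ Set.Ioc (0 : ℝ) 1, ∀ v ∈ Set.Ioc (0 : ℝ) 1, C u v = ψ (φ u + φ v))
    {μ : Measure (ℝ × ℝ)} [IsFiniteMeasure μ]
    (hμ : ∀ a b : ℝ, 0 ≤ a → 0 ≤ b →
      μ.real (Set.Icc 0 (ψ a) ×ˢ Set.Icc 0 (ψ b)) = ψ (a + b))
    {δ : ℝ} (hδ : 0 < δ) (n : ℕ) :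
    μ.real {p : ℝ × ℝ | p.1 ∈ Set.Icc (0 : ℝ) 1 ∧ p.2 ∈ Set.Icc (0 : ℝ) 1 ∧
        C p.1 p.2 ≤ ψ (n * δ)} ≤
      ψ (n * δ) + n * (ψ (n * δ - δ) - ψ (n * δ)) := by
  refine (measureReal_mono (h.sublevel_subset_strips hC hδ n)).trans
    ((measureReal_union_le _ _).trans ?_)
  rw [h.measureReal_left_strip hμ (by positivity)]
  gcongr
  refine (measureReal_biUnion_finset_le _ _).trans (le_of_eq ?_)
  rw [Finset.sum_congr rfl (g := fun _ => ψ (n * δ - δ) - ψ (n * δ))]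
  · simp [mul_sub]
  · intro k hk
    have hkn : k * δ + δ ≤ n * δ := by
      have : (k : ℝ) + 1 ≤ n := by exact_mod_cast Finset.mem_range.1 hk
      nlinarith
    rw [h.measureReal_strip hμ (by positivity) hδ.le (by linarith)]
    congr 2 <;> ring

/-- The Kendall distribution function of an Archimedean copula. -/
theorem measureReal_sublevel (h : IsArchimedeanPair φ ψ)
    (hC : ∀ u ∈ Set.Ioc (0 : ℝ) 1, ∀ v ∈ Set.Ioc (0 : ℝ) 1, C u v = ψ (φ u + φ v))
    (hC0 : ∀ u v : ℝ, u = 0 ∨ v = 0 → C u v = 0)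
    {μ : Measure (ℝ × ℝ)} [IsFiniteMeasure μ]
    (hμ : ∀ a b : ℝ, 0 ≤ a → 0 ≤ b →
      μ.real (Set.Icc 0 (ψ a) ×ˢ Set.Icc 0 (ψ b)) = ψ (a + b))
    {t d : ℝ} (ht : 0 < t) (hd : HasDerivAt ψ d t) :
    μ.real {p : ℝ × ℝ | p.1 ∈ Set.Icc (0 : ℝ) 1 ∧ p.2 ∈ Set.Icc (0 : ℝ) 1 ∧
        C p.1 p.2 ≤ ψ t} = ψ t - t * d := by
  have hslope := hasDerivAt_iff_tendsto_slope_zero.1 hd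
  have hstep : Tendsto (fun n : ℕ => t / n) atTop (𝓝 0) := tendsto_const_div_atTop_nhds_zero_nat t
  have hlim : ∀ ε : ℝ, ε ≠ 0 → Tendsto
      (fun n : ℕ => ψ t - t * ((ε * (t / n))⁻¹ • (ψ (t + ε * (t / n)) - ψ t)))
      atTop (𝓝 (ψ t - t * d)) := by
    intro ε hε
    refine ((hslope.comp (tendsto_nhdsWithin_iff.2 ⟨?_, ?_⟩)).const_mul t).const_sub _
    · simpa using hstep.const_mul ε
    · filter_upwards [eventually_gt_atTop 0] with n hn
      have : (0 : ℝ) < n := by exact_mod_cast hn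
      exact mul_ne_zero hε (by positivity)
  refine le_antisymm (ge_of_tendsto (hlim (-1) (by norm_num)) ?_)
    (le_of_tendsto (hlim 1 one_ne_zero) ?_)
  all_goals
    filter_upwards [eventually_gt_atTop 0] with n hn
    have hn' : (0 : ℝ) < n := by exact_mod_cast hn
    have hδ : 0 < t / n := by positivity
    have hnt : n * (t / n) = t := by field_simp
  · have := h.measureReal_sublevel_le hC hμ hδ n
    rw [hnt] at this
    refine this.trans (le_of_eq ?_)
    rw [neg_one_mul, ← sub_eq_add_neg, smul_eq_mul]
    field_simp
    ring
  · have := h.le_measureReal_sublevel hC hC0 hμ hδ n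
    rw [hnt] at this
    refine le_trans (le_of_eq ?_) this
    rw [one_mul, smul_eq_mul]
    field_simp
    ring

end IsArchimedeanPair

theorem isArchimedeanPair_transformedGumbel {α β : ℝ} (hα : 0 < α) (hβ : 0 < β) :
    IsArchimedeanPair (fun u => (u ^ (-α) - 1) ^ β)
      (fun t => (t ^ (1 / β) + 1) ^ (-(1 / α))) where
  strictAntiOn := by
    intro a ha b hb hab
    have ha : 0 ≤ a := ha
    have : a ^ (1 / β) < b ^ (1 / β) := Real.rpow_lt_rpow ha hab (by positivity)
    exact Real.rpow_lt_rpow_of_neg (by positivity) (by linarith)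
      (neg_lt_zero.2 (by positivity))
  map_mem t ht := by
    have : 0 ≤ t ^ (1 / β) := by positivity
    exact ⟨by positivity, Real.rpow_le_one_of_one_le_of_nonpos (by linarith)
      (neg_nonpos.2 (by positivity))⟩
  map_zero := by
    rw [Real.zero_rpow (by positivity)]
    simp
  left_inv t ht := by
    have : 0 ≤ t ^ (1 / β) := by positivity
    have hexp : -(1 / α) * -α = 1 := by field_simp
    rw [← Real.rpow_mul (by positivity), hexp, Real.rpow_one, add_sub_cancel_right,
      ← Real.rpow_mul ht, one_div_mul_cancel hβ.ne', Real.rpow_one]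
  inv_nonneg u hu := by
    have := Real.one_le_rpow_of_pos_of_le_one_of_nonpos hu.1 hu.2 (neg_nonpos.2 hα.le)
    exact Real.rpow_nonneg (by linarith) _
  right_inv u hu := by
    have := Real.one_le_rpow_of_pos_of_le_one_of_nonpos hu.1 hu.2 (neg_nonpos.2 hα.le)
    have hexp : -α * -(1 / α) = 1 := by field_simp
    rw [← Real.rpow_mul (by linarith), mul_one_div_cancel hβ.ne', Real.rpow_one,
      sub_add_cancel, ← Real.rpow_mul hu.1.le, hexp, Real.rpow_one]

theorem hasDerivAt_transformedGumbel {α β s : ℝ} (hα : 0 < α) (hβ : 0 < β)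
    (hs : s ∈ Set.Ioo (0 : ℝ) 1) :
    HasDerivAt (fun t : ℝ => (t ^ (1 / β) + 1) ^ (-(1 / α)))
      (-((s - s ^ (α + 1)) / (α * β)) / (s ^ (-α) - 1) ^ β) ((s ^ (-α) - 1) ^ β) := by
  have hx : 0 < s ^ (-α) - 1 :=
    sub_pos.2 (Real.one_lt_rpow_of_pos_of_lt_one_of_neg hs.1 hs.2 (neg_lt_zero.2 hα))
  have ht : 0 < (s ^ (-α) - 1) ^ β := by positivity
  have hroot : ((s ^ (-α) - 1) ^ β) ^ (1 / β) = s ^ (-α) - 1 := by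
    rw [← Real.rpow_mul hx.le, mul_one_div_cancel hβ.ne', Real.rpow_one]
  have hpos : 0 < s ^ (-α) := Real.rpow_pos_of_pos hs.1 _
  have hd := ((Real.hasDerivAt_rpow_const (p := 1 / β) (Or.inl ht.ne')).add_const 1).rpow_const
    (p := -(1 / α)) (Or.inl (by rw [hroot]; simpa using hpos.ne'))
  convert hd using 1
  have hexp : -α * (-(1 / α) - 1) = α + 1 := by field_simp; ring
  rw [hroot, sub_add_cancel, ← Real.rpow_mul hs.1.le, hexp, Real.rpow_sub_one ht.ne', hroot]
  have hmul : s ^ (-α) * s ^ (α + 1) = s := by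
    rw [← Real.rpow_add hs.1, neg_add_cancel_left, Real.rpow_one]
  field_simp
  linear_combination hmul

/-- Let `μ` be a probability measure on `[0,1]²` (viewed as a
measure on `ℝ × ℝ`) whose CDF is the bivariate transformed Gumbel copula
`C_{α,β}`, i.e. `μ([0,u]×[0,v]) = C_{α,β}(u,v)` for `(u,v) ∈ [0,1]²`. Then the
pushforward of `μ` under `(u,v) ↦ C_{α,β}(u,v)` has CDF
`K_{α,β}(s) = s + (s - s^{α+1})/(αβ)` on `[0,1]`. -/
theorem stmt_10 (α β : ℝ) (hα : 0 < α) (hβ : 1 ≤ β)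
    (C : ℝ → ℝ → ℝ)
    (hC : ∀ u v : ℝ, u ∈ Set.Ioc (0 : ℝ) 1 → v ∈ Set.Ioc (0 : ℝ) 1 →
      C u v = (((u ^ (-α) - 1) ^ β + (v ^ (-α) - 1) ^ β) ^ (1 / β) + 1)
        ^ (-(1 / α)))
    (hC0 : ∀ u v : ℝ, u = 0 ∨ v = 0 → C u v = 0)
    (μ : Measure (ℝ × ℝ)) [IsProbabilityMeasure μ]
    (hcdf : ∀ u v : ℝ, u ∈ Set.Icc (0 : ℝ) 1 → v ∈ Set.Icc (0 : ℝ) 1 →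
      μ (Set.Icc 0 u ×ˢ Set.Icc 0 v) = ENNReal.ofReal (C u v)) :
    ∀ s ∈ Set.Icc (0 : ℝ) 1,
      μ {p : ℝ × ℝ | p.1 ∈ Set.Icc (0 : ℝ) 1 ∧ p.2 ∈ Set.Icc (0 : ℝ) 1 ∧
          C p.1 p.2 ≤ s} =
        ENNReal.ofReal (s + (s - s ^ (α + 1)) / (α * β)) := by
  have hβ0 : 0 < β := by linarith
  have h := isArchimedeanPair_transformedGumbel hα hβ0
  set φ : ℝ → ℝ := fun u => (u ^ (-α) - 1) ^ β
  set ψ : ℝ → ℝ := fun t => (t ^ (1 / β) + 1) ^ (-(1 / α))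
  have hCψ : ∀ u ∈ Set.Ioc (0 : ℝ) 1, ∀ v ∈ Set.Ioc (0 : ℝ) 1, C u v = ψ (φ u + φ v) :=
    fun u hu v hv => hC u v hu hv
  have hCmem : ∀ u ∈ Set.Ioc (0 : ℝ) 1, ∀ v ∈ Set.Ioc (0 : ℝ) 1, C u v ∈ Set.Ioc (0 : ℝ) 1 :=
    fun u hu v hv => hCψ u hu v hv ▸
      h.map_mem _ (add_nonneg (h.inv_nonneg u hu) (h.inv_nonneg v hv))
  rintro s ⟨hs0, hs1⟩
  rcases hs0.eq_or_lt with rfl | hs0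
  · rw [Real.zero_rpow (by positivity)]
    simp only [sub_zero, zero_div, add_zero, ENNReal.ofReal_zero]
    have hleft := hcdf 0 1 (by simp) (by simp)
    have hright := hcdf 1 0 (by simp) (by simp)
    rw [hC0 _ _ (Or.inl rfl), ENNReal.ofReal_zero] at hleft
    rw [hC0 _ _ (Or.inr rfl), ENNReal.ofReal_zero] at hright
    refine measure_mono_null ?_ (measure_union_null hleft hright)
    rintro ⟨u, v⟩ ⟨⟨hu0, hu1⟩, ⟨hv0, hv1⟩, hle⟩
    dsimp only at hu0 hu1 hv0 hv1 hle
    rcases hu0.eq_or_lt with rfl | hu0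
    · exact Or.inl ⟨by simp, hv0, hv1⟩
    rcases hv0.eq_or_lt with rfl | hv0
    · exact Or.inr ⟨⟨hu0.le, hu1⟩, by simp⟩
    exact absurd hle (hCmem u ⟨hu0, hu1⟩ v ⟨hv0, hv1⟩).1.not_ge
  rcases hs1.eq_or_lt with rfl | hs1
  · have hset : {p : ℝ × ℝ | p.1 ∈ Set.Icc (0 : ℝ) 1 ∧ p.2 ∈ Set.Icc (0 : ℝ) 1 ∧ C p.1 p.2 ≤ 1} =
        Set.Icc 0 1 ×ˢ Set.Icc 0 1 := by
      ext ⟨u, v⟩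
      refine ⟨fun hp => ⟨hp.1, hp.2.1⟩, fun hp => ⟨hp.1, hp.2, ?_⟩⟩
      obtain ⟨⟨hu0, hu1⟩, hv0, hv1⟩ := hp
      dsimp only at hu0 hu1 hv0 hv1 ⊢
      rcases hu0.eq_or_lt with rfl | hu0
      · simp [hC0]
      rcases hv0.eq_or_lt with rfl | hv0
      · simp [hC0]
      exact (hCmem u ⟨hu0, hu1⟩ v ⟨hv0, hv1⟩).2
    rw [hset, hcdf 1 1 (by simp) (by simp), hC 1 1 (by simp) (by simp)]
    simp [Real.zero_rpow, hβ0.ne']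
  have hμ : ∀ a b : ℝ, 0 ≤ a → 0 ≤ b →
      μ.real (Set.Icc 0 (ψ a) ×ˢ Set.Icc 0 (ψ b)) = ψ (a + b) := by
    intro a b ha hb
    have hma := h.map_mem a ha
    have hmb := h.map_mem b hb
    rw [measureReal_def, hcdf _ _ ⟨hma.1.le, hma.2⟩ ⟨hmb.1.le, hmb.2⟩,
      ENNReal.toReal_ofReal (hCmem _ hma _ hmb).1.le, hCψ _ hma _ hmb,
      h.left_inv a ha, h.left_inv b hb]
  have ht : 0 < φ s := Real.rpow_pos_of_pos (sub_pos.2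
    (Real.one_lt_rpow_of_pos_of_lt_one_of_neg hs0 hs1 (neg_lt_zero.2 hα))) _
  have key := h.measureReal_sublevel hCψ hC0 hμ ht
    (hasDerivAt_transformedGumbel hα hβ0 ⟨hs0, hs1⟩)
  rw [h.right_inv s ⟨hs0, hs1.le⟩] at key
  rw [← ofReal_measureReal, key]
  congr 1
  change s - φ s * (-((s - s ^ (α + 1)) / (α * β)) / φ s) = _
  rw [mul_div_cancel₀ _ ht.ne', sub_neg_eq_add]
end

section
/- Let μ be a probability measure on [0,1]² whose cumulative distribution function is C_{α,β}. Then ∫_{[0,1]²} C_{α,β}(u,v) dμ(u,v) = (2β + αβ − 1)/(4β + 2αβ), and consequently Kendall's tau of C_{α,β}, defined by τ(α,β) = 4∫_{[0,1]²} C_{α,β}(u,v) dμ(u,v) − 1, equals τ(α,β) = 1 − 2/(β(α+2)). -/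
open MeasureTheory Set Filter Topology

/-- The Archimedean generator inverse `s ↦ (s ^ k + 1) ^ (-a)`. -/
noncomputable def psi (k a s : ℝ) : ℝ := (s ^ k + 1) ^ (-a)

/-- The first derivative of `psi` on `(0, ∞)`. -/
noncomputable def psiDeriv (k a s : ℝ) : ℝ :=
  -(a * k * s ^ (k - 1) * (s ^ k + 1) ^ (-a - 1))

/-- The second derivative of `psi` on `(0, ∞)`. -/
noncomputable def psiDeriv₂ (k a s : ℝ) : ℝ :=
  a * k * ((1 - k) * s ^ (k - 1 - 1) * (s ^ k + 1) ^ (-a - 1) +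
    (a + 1) * k * (s ^ (k - 1) * s ^ (k - 1)) * (s ^ k + 1) ^ (-a - 1 - 1))

section Generator

variable {k a s : ℝ}

lemma rpow_add_one_pos (hs : 0 ≤ s) : 0 < s ^ k + 1 := by positivity

lemma psi_pos (hs : 0 ≤ s) : 0 < psi k a s := Real.rpow_pos_of_pos (rpow_add_one_pos hs) _

lemma psi_zero (hk : 0 < k) : psi k a 0 = 1 := by simp [psi, Real.zero_rpow hk.ne']

lemma measurable_psi : Measurable (psi k a) := by unfold psi; fun_prop

lemma measurable_psiDeriv₂ : Measurable (psiDeriv₂ k a) := by unfold psiDeriv₂; fun_prop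

lemma hasDerivAt_psi (hs : 0 < s) : HasDerivAt (psi k a) (psiDeriv k a s) s := by
  have h := ((Real.hasDerivAt_rpow_const (p := k) (Or.inl hs.ne')).add_const 1).rpow_const
    (p := -a) (Or.inl (rpow_add_one_pos hs.le).ne')
  refine h.congr_deriv ?_
  rw [psiDeriv]
  ring

lemma hasDerivAt_psiDeriv (hs : 0 < s) :
    HasDerivAt (psiDeriv k a) (psiDeriv₂ k a s) s := by
  have h1 := Real.hasDerivAt_rpow_const (p := k - 1) (Or.inl hs.ne')
  have h2 := ((Real.hasDerivAt_rpow_const (p := k) (Or.inl hs.ne')).add_const 1).rpow_const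
    (p := -a - 1) (Or.inl (rpow_add_one_pos hs.le).ne')
  refine (((h1.const_mul (a * k)).mul h2).neg).congr_deriv ?_
  rw [psiDeriv₂]
  ring

lemma psiDeriv_nonpos (hk : 0 < k) (ha : 0 < a) (hs : 0 ≤ s) : psiDeriv k a s ≤ 0 := by
  have := rpow_add_one_pos (k := k) hs
  rw [psiDeriv, neg_nonpos]
  positivity

lemma psiDeriv₂_nonneg (hk : 0 < k) (hk1 : k ≤ 1) (ha : 0 < a) (hs : 0 ≤ s) :
    0 ≤ psiDeriv₂ k a s := by
  have := rpow_add_one_pos (k := k) hs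
  have : 0 ≤ 1 - k := by linarith
  rw [psiDeriv₂]
  positivity

lemma continuousWithinAt_psi (hk : 0 < k) (hs : 0 ≤ s) :
    ContinuousWithinAt (psi k a) (Ici s) s :=
  ((((Real.continuousAt_rpow_const s k (Or.inr hk.le)).add_const 1).rpow_const
    (Or.inl (rpow_add_one_pos hs).ne'))).continuousWithinAt

lemma tendsto_psi (hk : 0 < k) (ha : 0 < a) : Tendsto (psi k a) atTop (𝓝 0) :=
  (tendsto_rpow_neg_atTop ha).comp (tendsto_atTop_add_const_right _ 1 (tendsto_rpow_atTop hk))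

lemma tendsto_psiDeriv (hk : 0 < k) (hk1 : k ≤ 1) (ha : 0 < a) :
    Tendsto (psiDeriv k a) atTop (𝓝 0) := by
  have h : Tendsto (fun s => a * k * (s ^ k + 1) ^ (-(a + 1))) atTop (𝓝 (a * k * 0)) :=
    ((tendsto_rpow_neg_atTop (by linarith : 0 < a + 1)).comp
      (tendsto_atTop_add_const_right _ 1 (tendsto_rpow_atTop hk))).const_mul _
  rw [mul_zero] at h
  refine squeeze_zero_norm' ?_ h
  filter_upwards [eventually_ge_atTop 1] with s hs
  have hs0 : (0 : ℝ) ≤ s := by linarith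
  have hw := rpow_add_one_pos (k := k) hs0
  have h1 : s ^ (k - 1) ≤ 1 := Real.rpow_le_one_of_one_le_of_nonpos hs (by linarith)
  rw [Real.norm_of_nonpos (psiDeriv_nonpos hk ha hs0), psiDeriv, neg_neg, neg_add']
  rw [mul_right_comm]
  exact mul_le_of_le_one_right (by positivity) h1

lemma mul_psiDeriv (ha : 0 < a) (hk : 0 < k) (hs : 0 ≤ s) :
    s * psiDeriv k a s = -(a * k) * (psi k a s - psi k a s ^ (1 / a + 1)) := by
  have hw := rpow_add_one_pos (k := k) hs
  have h1 : psi k a s ^ (1 / a + 1) = (s ^ k + 1) ^ (-a - 1) := by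
    rw [psi, ← Real.rpow_mul hw.le]
    congr 1
    field_simp
    ring
  have h2 : psi k a s = (s ^ k + 1) ^ (-a - 1) * (s ^ k + 1) := by
    rw [psi, ← Real.rpow_add_one hw.ne']
    ring_nf
  have h3 : s * s ^ (k - 1) = s ^ k := by
    rcases hs.eq_or_lt with rfl | hs
    · simp [Real.zero_rpow hk.ne']
    · rw [mul_comm, ← Real.rpow_add_one hs.ne']
      ring_nf
  rw [h1, h2, psiDeriv, ← h3]
  ring

/-- Composed with `psi`, an antiderivative of the identity times `psi` times its second derivative. -/
noncomputable def kendallPrimitive (k a t : ℝ) : ℝ :=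
  -(a * k) * (t ^ 2 - t ^ (1 / a + 2)) - t ^ 2 / 2 +
    a * k * (t ^ 2 / 2 - t ^ (1 / a + 2) / (1 / a + 2))

lemma continuous_kendallPrimitive (ha : 0 < a) : Continuous (kendallPrimitive k a) := by
  have : Continuous fun t : ℝ => t ^ (1 / a + 2) :=
    Real.continuous_rpow_const (by positivity)
  unfold kendallPrimitive
  fun_prop

lemma hasDerivAt_kendallPrimitive_psi (hk : 0 < k) (ha : 0 < a) (hs : 0 < s) :
    HasDerivAt (fun s => kendallPrimitive k a (psi k a s))
      (s * (psi k a s * psiDeriv₂ k a s)) s := by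
  have hpos := psi_pos (k := k) (a := a) hs.le
  have hψ := hasDerivAt_psi (k := k) (a := a) hs
  have H := ((((hasDerivAt_id s).mul hψ).mul (hasDerivAt_psiDeriv (k := k) (a := a) hs)).sub
    ((hψ.pow 2).div_const 2)).add ((((hψ.pow 2).div_const 2).sub
      ((hψ.rpow_const (p := 1 / a + 2) (Or.inl hpos.ne')).div_const (1 / a + 2))).const_mul (a * k))
  refine (H.congr_deriv ?_).congr_of_eventuallyEq ?_
  · have h := mul_psiDeriv ha hk hs.le
    have h2 : 1 / a + 2 ≠ 0 := by positivity
    have h3 : 1 / a + 2 - 1 = 1 / a + 1 := by ring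
    rw [h3]
    simp only [Pi.mul_apply, id]
    field_simp
    field_simp at h
    linear_combination (2 * psiDeriv k a s) * h
  · filter_upwards [lt_mem_nhds hs] with x hx
    have h := mul_psiDeriv ha hk (le_of_lt hx)
    have h4 : psi k a x ^ (1 / a + 2) = psi k a x ^ (1 / a + 1) * psi k a x := by
      rw [← Real.rpow_add_one (psi_pos (le_of_lt hx)).ne']
      ring_nf
    simp only [kendallPrimitive, Pi.mul_apply, Pi.sub_apply, Pi.add_apply, Pi.pow_apply, id, h4]
    linear_combination (-psi k a x) * h

lemma kendallPrimitive_one :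
    kendallPrimitive k a 1 = -(1 / 2 - a * k * (1 / 2 - 1 / (1 / a + 2))) := by
  simp [kendallPrimitive]
  ring

lemma kendallPrimitive_zero (ha : 0 < a) : kendallPrimitive k a 0 = 0 := by
  have h : 1 / a + 2 ≠ 0 := by positivity
  simp only [kendallPrimitive, Real.zero_rpow h]
  simp

end Generator

section Law

variable {k a : ℝ}

lemma lintegral_Ioi_of_hasDerivAt {g g' : ℝ → ℝ} {c l : ℝ}
    (hcont : ContinuousWithinAt g (Ici c) c) (hderiv : ∀ x ∈ Ioi c, HasDerivAt g (g' x) x)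
    (hpos : ∀ x ∈ Ioi c, 0 ≤ g' x) (hg : Tendsto g atTop (𝓝 l)) :
    ∫⁻ x in Ioi c, ENNReal.ofReal (g' x) = ENNReal.ofReal (l - g c) := by
  rw [← integral_Ioi_of_hasDerivAt_of_nonneg hcont hderiv hpos hg,
    ofReal_integral_eq_lintegral_ofReal (integrableOn_Ioi_deriv_of_nonneg hcont hderiv hpos hg)]
  exact (ae_restrict_iff' measurableSet_Ioi).2 (ae_of_all _ hpos)

lemma setLIntegral_Ioi_comp_add_left (f : ℝ → ENNReal) (x b : ℝ) :
    ∫⁻ y in Ioi b, f (x + y) = ∫⁻ s in Ioi (x + b), f s := by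
  rw [(measurePreserving_add_left volume x).setLIntegral_comp_emb
    (measurableEmbedding_addLeft x) f (Ioi b), image_const_add_Ioi]

lemma lintegral_Ioi_lintegral_Ioi_add {f : ℝ → ENNReal} (hf : Measurable f) :
    ∫⁻ x in Ioi (0 : ℝ), ∫⁻ y in Ioi (0 : ℝ), f (x + y) =
      ∫⁻ s in Ioi (0 : ℝ), ENNReal.ofReal s * f s := by
  have h1 : ∀ x ∈ Ioi (0 : ℝ), ∫⁻ y in Ioi (0 : ℝ), f (x + y) =
      ∫⁻ s in Ioi (0 : ℝ), {p : ℝ × ℝ | p.1 < p.2}.indicator (fun p => f p.2) (x, s) := by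
    intro x hx
    rw [setLIntegral_Ioi_comp_add_left, add_zero]
    change _ = ∫⁻ s in Ioi (0 : ℝ), (Ioi x).indicator f s
    rw [setLIntegral_indicator measurableSet_Ioi,
      inter_eq_left.2 (Ioi_subset_Ioi (le_of_lt hx))]
  have h2 : ∀ s ∈ Ioi (0 : ℝ), ∫⁻ x in Ioi (0 : ℝ),
      {p : ℝ × ℝ | p.1 < p.2}.indicator (fun p => f p.2) (x, s) = ENNReal.ofReal s * f s := by
    intro s _
    change ∫⁻ x in Ioi (0 : ℝ), (Iio s).indicator (fun _ => f s) x = _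
    rw [setLIntegral_indicator measurableSet_Iio, setLIntegral_const, inter_comm, Ioi_inter_Iio,
      Real.volume_Ioo, sub_zero, mul_comm]
  rw [setLIntegral_congr_fun measurableSet_Ioi h1, lintegral_lintegral_swap,
    setLIntegral_congr_fun measurableSet_Ioi h2]
  exact ((hf.comp measurable_snd).indicator
    (measurableSet_lt measurable_fst measurable_snd)).aemeasurable

/-- The law on the open positive quadrant with joint survival function
`(x, y) ↦ psi k a (x + y)`. -/
noncomputable def survivalLaw (k a : ℝ) : Measure (ℝ × ℝ) :=
  ((volume.restrict (Ioi (0 : ℝ))).prod (volume.restrict (Ioi (0 : ℝ)))).withDensity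
    fun p => ENNReal.ofReal (psiDeriv₂ k a (p.1 + p.2))

lemma measurable_ofReal_psiDeriv₂_add :
    Measurable fun p : ℝ × ℝ => ENNReal.ofReal (psiDeriv₂ k a (p.1 + p.2)) :=
  (measurable_psiDeriv₂.comp (measurable_fst.add measurable_snd)).ennreal_ofReal

lemma ae_survivalLaw_pos : ∀ᵐ p ∂survivalLaw k a, 0 < p.1 ∧ 0 < p.2 := by
  refine (withDensity_absolutelyContinuous _ _).ae_le ?_
  rw [Measure.prod_restrict]
  exact ae_restrict_mem (measurableSet_Ioi.prod measurableSet_Ioi)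

lemma restrict_Ioi_restrict_Ici {x : ℝ} (hx : 0 ≤ x) :
    (volume.restrict (Ioi (0 : ℝ))).restrict (Ici x) = volume.restrict (Ioi x) := by
  rw [Measure.restrict_restrict measurableSet_Ici]
  refine Measure.restrict_congr_set ?_
  have h : (Ici x ∩ Ioi 0 : Set ℝ) =ᵐ[volume] (Ioi x ∩ Ioi 0 : Set ℝ) :=
    Ioi_ae_eq_Ici.symm.inter (ae_eq_refl _)
  rwa [inter_eq_left.2 (Ioi_subset_Ioi hx)] at h

lemma survivalLaw_Ici_prod_Ici (hk : 0 < k) (hk1 : k ≤ 1) (ha : 0 < a) {x y : ℝ}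
    (hx : 0 ≤ x) (hy : 0 ≤ y) :
    survivalLaw k a (Ici x ×ˢ Ici y) = ENNReal.ofReal (psi k a (x + y)) := by
  have inner : ∀ t ∈ Ioi x, ∫⁻ s in Ioi y, ENNReal.ofReal (psiDeriv₂ k a (t + s)) =
      ENNReal.ofReal (-psiDeriv k a (y + t)) := by
    intro t ht
    have ht0 : 0 < t + y := by have := mem_Ioi.1 ht; linarith
    rw [setLIntegral_Ioi_comp_add_left (fun s => ENNReal.ofReal (psiDeriv₂ k a s)),
      lintegral_Ioi_of_hasDerivAt (hasDerivAt_psiDeriv ht0).continuousAt.continuousWithinAt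
        (fun s hs => hasDerivAt_psiDeriv (ht0.trans hs))
        (fun s hs => psiDeriv₂_nonneg hk hk1 ha (ht0.trans hs).le)
        (tendsto_psiDeriv hk hk1 ha), zero_sub, add_comm]
  have hxy : 0 ≤ y + x := by positivity
  have hpos {s : ℝ} (hs : s ∈ Ioi (y + x)) : 0 < s := hxy.trans_lt hs
  rw [survivalLaw, withDensity_apply _ (measurableSet_Ici.prod measurableSet_Ici),
    ← Measure.prod_restrict, restrict_Ioi_restrict_Ici hx, restrict_Ioi_restrict_Ici hy,
    lintegral_prod _ measurable_ofReal_psiDeriv₂_add.aemeasurable,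
    setLIntegral_congr_fun measurableSet_Ioi inner,
    setLIntegral_Ioi_comp_add_left (fun s => ENNReal.ofReal (-psiDeriv k a s)),
    lintegral_Ioi_of_hasDerivAt (continuousWithinAt_psi hk hxy).neg
      (fun s hs => (hasDerivAt_psi (hpos hs)).neg)
      (fun s hs => neg_nonneg.2 (psiDeriv_nonpos hk ha (hpos hs).le)) (tendsto_psi hk ha).neg]
  simp [add_comm]

lemma lintegral_psi_add_survivalLaw (hk : 0 < k) (hk1 : k ≤ 1) (ha : 0 < a) :
    ∫⁻ p, ENNReal.ofReal (psi k a (p.1 + p.2)) ∂survivalLaw k a =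
      ENNReal.ofReal (1 / 2 - a * k * (1 / 2 - 1 / (1 / a + 2))) := by
  have hψ := (measurable_psi (k := k) (a := a)).ennreal_ofReal
  have hψ₂ := (measurable_psiDeriv₂ (k := k) (a := a)).ennreal_ofReal
  have hψ_add : Measurable fun p : ℝ × ℝ => ENNReal.ofReal (psi k a (p.1 + p.2)) :=
    hψ.comp (measurable_fst.add measurable_snd)
  have hF := continuous_kendallPrimitive (k := k) ha
  have hlim : Tendsto (fun s => kendallPrimitive k a (psi k a s)) atTop (𝓝 0) := by
    have h := (hF.tendsto 0).comp (tendsto_psi hk ha)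
    rwa [kendallPrimitive_zero ha] at h
  have hcongr : ∀ s ∈ Ioi (0 : ℝ),
      ENNReal.ofReal s * (ENNReal.ofReal (psiDeriv₂ k a s) * ENNReal.ofReal (psi k a s)) =
        ENNReal.ofReal (s * (psi k a s * psiDeriv₂ k a s)) := by
    intro s hs
    have hs' := (mem_Ioi.1 hs).le
    rw [← ENNReal.ofReal_mul (psiDeriv₂_nonneg hk hk1 ha hs'), ← ENNReal.ofReal_mul hs',
      mul_comm (psiDeriv₂ k a s)]
  rw [survivalLaw, lintegral_withDensity_eq_lintegral_mul _ measurable_ofReal_psiDeriv₂_add hψ_add,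
    lintegral_prod _ (measurable_ofReal_psiDeriv₂_add.mul hψ_add).aemeasurable]
  refine (lintegral_Ioi_lintegral_Ioi_add (hψ₂.mul hψ)).trans ?_
  refine (setLIntegral_congr_fun measurableSet_Ioi hcongr).trans ?_
  rw [lintegral_Ioi_of_hasDerivAt
    (hF.continuousAt.comp_continuousWithinAt (continuousWithinAt_psi hk le_rfl))
    (fun s hs => hasDerivAt_kendallPrimitive_psi hk ha hs)
    (fun s hs => mul_nonneg (le_of_lt hs) (mul_nonneg (psi_pos (le_of_lt hs)).le
      (psiDeriv₂_nonneg hk hk1 ha (le_of_lt hs)))) hlim]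
  rw [Function.comp_apply, psi_zero hk, kendallPrimitive_one, zero_sub, neg_neg]

end Law

section Copula

variable {α β u v s : ℝ}

/-- The Archimedean generator `u ↦ (u ^ (-α) - 1) ^ β` of the transformed Gumbel copula. -/
noncomputable def gumbelGenerator (α β u : ℝ) : ℝ := (u ^ (-α) - 1) ^ β

lemma rpow_neg_sub_one_nonneg (hα : 0 < α) (hu : u ∈ Ioc (0 : ℝ) 1) : 0 ≤ u ^ (-α) - 1 :=
  sub_nonneg.2 (Real.one_le_rpow_of_pos_of_le_one_of_nonpos hu.1 hu.2 (by linarith))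

lemma gumbelGenerator_nonneg (hα : 0 < α) (hu : u ∈ Ioc (0 : ℝ) 1) :
    0 ≤ gumbelGenerator α β u :=
  Real.rpow_nonneg (rpow_neg_sub_one_nonneg hα hu) _

lemma psi_gumbelGenerator (hα : 0 < α) (hβ : 0 < β) (hu : u ∈ Ioc (0 : ℝ) 1) :
    psi (1 / β) (1 / α) (gumbelGenerator α β u) = u := by
  rw [psi, gumbelGenerator, one_div β, Real.rpow_rpow_inv (rpow_neg_sub_one_nonneg hα hu) hβ.ne',
    sub_add_cancel, ← Real.rpow_mul hu.1.le]
  field_simp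
  exact Real.rpow_one u

lemma strictAntiOn_psi {k a : ℝ} (hk : 0 < k) (ha : 0 < a) : StrictAntiOn (psi k a) (Ici 0) := by
  intro x hx y _ hxy
  exact Real.rpow_lt_rpow_of_neg (rpow_add_one_pos hx)
    (by gcongr) (neg_neg_of_pos ha)

lemma psi_mem_Ioc {k a : ℝ} (hk : 0 < k) (ha : 0 < a) (hs : 0 ≤ s) :
    psi k a s ∈ Ioc (0 : ℝ) 1 :=
  ⟨psi_pos hs, psi_zero (a := a) hk ▸ (strictAntiOn_psi hk ha).antitoneOn self_mem_Ici hs hs⟩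

lemma gumbelGenerator_psi (hα : 0 < α) (hβ : 0 < β) (hs : 0 ≤ s) :
    gumbelGenerator α β (psi (1 / β) (1 / α) s) = s := by
  have hk : 0 < 1 / β := by positivity
  have ha : 0 < 1 / α := by positivity
  have h := psi_mem_Ioc hk ha hs
  exact (strictAntiOn_psi hk ha).injOn (gumbelGenerator_nonneg hα h) hs
    (psi_gumbelGenerator hα hβ h)

lemma psi_le_iff (hα : 0 < α) (hβ : 0 < β) (hs : 0 ≤ s) (hu : 0 < u) :
    psi (1 / β) (1 / α) s ≤ u ↔ gumbelGenerator α β (min u 1) ≤ s := by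
  have hk : 0 < 1 / β := by positivity
  have ha : 0 < 1 / α := by positivity
  have hm : min u 1 ∈ Ioc (0 : ℝ) 1 := ⟨lt_min hu one_pos, min_le_right _ _⟩
  rw [← (strictAntiOn_psi hk ha).le_iff_ge hs (gumbelGenerator_nonneg (β := β) hα hm),
    psi_gumbelGenerator hα hβ hm, le_min_iff, and_iff_left (psi_mem_Ioc hk ha hs).2]

/-- The law of `(psi X, psi Y)` when `(X, Y)` has law `survivalLaw`. -/
noncomputable def gumbelLaw (α β : ℝ) : Measure (ℝ × ℝ) :=
  (survivalLaw (1 / β) (1 / α)).map (Prod.map (psi (1 / β) (1 / α)) (psi (1 / β) (1 / α)))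

lemma gumbelLaw_Iic_prod_Iic (hα : 0 < α) (hβ : 1 ≤ β) (hu : 0 < u) (hv : 0 < v) :
    gumbelLaw α β (Iic u ×ˢ Iic v) = ENNReal.ofReal (psi (1 / β) (1 / α)
      (gumbelGenerator α β (min u 1) + gumbelGenerator α β (min v 1))) := by
  have hβ0 : 0 < β := by linarith
  rw [gumbelLaw, Measure.map_apply (measurable_psi.prodMap measurable_psi)
      (measurableSet_Iic.prod measurableSet_Iic),
    ← survivalLaw_Ici_prod_Ici (by positivity) ((div_le_one hβ0).2 hβ) (by positivity)
      (gumbelGenerator_nonneg hα ⟨lt_min hu one_pos, min_le_right _ _⟩)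
      (gumbelGenerator_nonneg hα ⟨lt_min hv one_pos, min_le_right _ _⟩)]
  refine measure_congr ?_
  filter_upwards [ae_survivalLaw_pos] with p hp
  exact propext (and_congr (psi_le_iff hα hβ0 hp.1.le hu) (psi_le_iff hα hβ0 hp.2.le hv))

lemma ae_gumbelLaw_mem (hα : 0 < α) (hβ : 0 < β) :
    ∀ᵐ p ∂gumbelLaw α β, p ∈ Ioc (0 : ℝ) 1 ×ˢ Ioc (0 : ℝ) 1 := by
  refine (ae_map_iff (measurable_psi.prodMap measurable_psi).aemeasurable
    (measurableSet_Ioc.prod measurableSet_Ioc)).2 ?_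
  filter_upwards [ae_survivalLaw_pos] with p hp
  exact ⟨psi_mem_Ioc (by positivity) (by positivity) hp.1.le,
    psi_mem_Ioc (by positivity) (by positivity) hp.2.le⟩

lemma measure_ext_of_Iic_prod_Iic {μ ν : Measure (ℝ × ℝ)} [IsFiniteMeasure μ]
    (h : ∀ u v, μ (Iic u ×ˢ Iic v) = ν (Iic u ×ˢ Iic v)) (huniv : μ univ = ν univ) : μ = ν := by
  have hspan : IsCountablySpanning (range (Iic : ℝ → Set ℝ)) :=
    ⟨fun n : ℕ => Iic (n : ℝ), fun n => mem_range_self _,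
      iUnion_eq_univ_iff.2 fun x => exists_nat_ge x⟩
  have hgen : MeasurableSpace.generateFrom (range (Iic : ℝ → Set ℝ)) = Real.measurableSpace :=
    (borel_eq_generateFrom_Iic ℝ).symm
  refine ext_of_generate_finite _ (generateFrom_eq_prod hgen hgen hspan hspan).symm
    (isPiSystem_Iic.prod isPiSystem_Iic) ?_ huniv
  rintro _ ⟨_, ⟨u, rfl⟩, _, ⟨v, rfl⟩, rfl⟩
  exact h u v

lemma measure_Iic_prod_Iic_eq_zero {μ : Measure (ℝ × ℝ)}
    (h : ∀ᵐ p ∂μ, p ∈ Ioc (0 : ℝ) 1 ×ˢ Ioc (0 : ℝ) 1) (huv : u ≤ 0 ∨ v ≤ 0) :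
    μ (Iic u ×ˢ Iic v) = 0 := by
  refine measure_mono_null ?_ h
  rintro p ⟨hpu, hpv⟩ ⟨hp1, hp2⟩
  rcases huv with hu | hv
  · exact (hp1.1.trans_le hpu).not_ge hu
  · exact (hp2.1.trans_le hpv).not_ge hv

lemma eq_gumbelLaw {μ : Measure (ℝ × ℝ)} [IsProbabilityMeasure μ] (hα : 0 < α) (hβ : 1 ≤ β)
    (hmem : ∀ᵐ p ∂μ, p ∈ Ioc (0 : ℝ) 1 ×ˢ Ioc (0 : ℝ) 1)
    (hcdf : ∀ u ∈ Ioc (0 : ℝ) 1, ∀ v ∈ Ioc (0 : ℝ) 1, μ (Icc 0 u ×ˢ Icc 0 v) =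
      ENNReal.ofReal (psi (1 / β) (1 / α) (gumbelGenerator α β u + gumbelGenerator α β v))) :
    μ = gumbelLaw α β := by
  have hmem' := ae_gumbelLaw_mem hα (one_pos.trans_le hβ)
  have key : ∀ u v : ℝ, μ (Iic u ×ˢ Iic v) = gumbelLaw α β (Iic u ×ˢ Iic v) := by
    intro u v
    rcases le_or_gt u 0 with hu | hu
    · rw [measure_Iic_prod_Iic_eq_zero hmem (Or.inl hu),
        measure_Iic_prod_Iic_eq_zero hmem' (Or.inl hu)]
    rcases le_or_gt v 0 with hv | hv
    · rw [measure_Iic_prod_Iic_eq_zero hmem (Or.inr hv),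
        measure_Iic_prod_Iic_eq_zero hmem' (Or.inr hv)]
    rw [gumbelLaw_Iic_prod_Iic hα hβ hu hv, ← hcdf _ ⟨lt_min hu one_pos, min_le_right _ _⟩ _
      ⟨lt_min hv one_pos, min_le_right _ _⟩]
    refine measure_congr ?_
    filter_upwards [hmem] with p hp
    refine propext (and_congr ?_ ?_)
    · exact ⟨fun h => ⟨hp.1.1.le, le_min h hp.1.2⟩, fun h => h.2.trans (min_le_left _ _)⟩
    · exact ⟨fun h => ⟨hp.2.1.le, le_min h hp.2.2⟩, fun h => h.2.trans (min_le_left _ _)⟩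
  refine measure_ext_of_Iic_prod_Iic key ?_
  have h1 : ∀ {ρ : Measure (ℝ × ℝ)}, (∀ᵐ p ∂ρ, p ∈ Ioc (0 : ℝ) 1 ×ˢ Ioc (0 : ℝ) 1) →
      ρ univ = ρ (Iic 1 ×ˢ Iic 1) := by
    intro ρ hρ
    refine measure_congr ?_
    filter_upwards [hρ] with p hp
    exact propext (iff_of_true trivial ⟨hp.1.2, hp.2.2⟩)
  rw [h1 hmem, h1 hmem', key]

lemma integral_gumbelLaw (hα : 0 < α) (hβ : 1 ≤ β) :
    ∫ p, psi (1 / β) (1 / α) (gumbelGenerator α β p.1 + gumbelGenerator α β p.2) ∂gumbelLaw α β =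
      (2 * β + α * β - 1) / (4 * β + 2 * α * β) := by
  have hβ0 : 0 < β := by linarith
  have hk : 0 < 1 / β := by positivity
  have ha : 0 < 1 / α := by positivity
  have hgen : Measurable (gumbelGenerator α β) := by unfold gumbelGenerator; fun_prop
  have hmeas : Measurable fun p : ℝ × ℝ =>
      psi (1 / β) (1 / α) (gumbelGenerator α β p.1 + gumbelGenerator α β p.2) :=
    measurable_psi.comp ((hgen.comp measurable_fst).add (hgen.comp measurable_snd))
  have hadd : Measurable fun p : ℝ × ℝ => psi (1 / β) (1 / α) (p.1 + p.2) :=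
    measurable_psi.comp (measurable_fst.add measurable_snd)
  rw [gumbelLaw, integral_map (measurable_psi.prodMap measurable_psi).aemeasurable
    hmeas.aestronglyMeasurable]
  have hcongr : (fun p : ℝ × ℝ => psi (1 / β) (1 / α)
      (gumbelGenerator α β (Prod.map (psi (1 / β) (1 / α)) (psi (1 / β) (1 / α)) p).1 +
        gumbelGenerator α β (Prod.map (psi (1 / β) (1 / α)) (psi (1 / β) (1 / α)) p).2))
      =ᵐ[survivalLaw (1 / β) (1 / α)] fun p => psi (1 / β) (1 / α) (p.1 + p.2) := by
    filter_upwards [ae_survivalLaw_pos] with p hp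
    rw [Prod.map_fst, Prod.map_snd, gumbelGenerator_psi hα hβ0 hp.1.le,
      gumbelGenerator_psi hα hβ0 hp.2.le]
  have hnonneg : 0 ≤ᵐ[survivalLaw (1 / β) (1 / α)]
      fun p => psi (1 / β) (1 / α) (p.1 + p.2) := by
    filter_upwards [ae_survivalLaw_pos] with p hp
    exact (psi_pos (add_pos hp.1 hp.2).le).le
  have hval : 1 / 2 - 1 / α * (1 / β) * (1 / 2 - 1 / (1 / (1 / α) + 2)) =
      (2 * β + α * β - 1) / (4 * β + 2 * α * β) := by
    have : 4 * β + 2 * α * β ≠ 0 := by positivity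
    have : α + 2 ≠ 0 := by positivity
    rw [one_div_one_div]
    field_simp
    ring
  have hval_nonneg : 0 ≤ (2 * β + α * β - 1) / (4 * β + 2 * α * β) := by
    have : 0 < α * β := by positivity
    exact div_nonneg (by linarith) (by linarith)
  rw [integral_congr_ae hcongr,
    integral_eq_lintegral_of_nonneg_ae hnonneg hadd.aestronglyMeasurable,
    lintegral_psi_add_survivalLaw hk ((div_le_one hβ0).2 hβ) ha, hval,
    ENNReal.toReal_ofReal hval_nonneg]

end Copula

/-- Let `μ` be a probability measure on `[0,1]²` whose CDF is
the bivariate transformed Gumbel copula `C_{α,β}`. Then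
`∫ C_{α,β} dμ = (2β + αβ - 1)/(4β + 2αβ)`, and consequently Kendall's tau
`τ(α,β) = 4 ∫ C_{α,β} dμ - 1` equals `1 - 2/(β(α+2))`. -/
theorem stmt_11 (α β : ℝ) (hα : 0 < α) (hβ : 1 ≤ β)
    (C : ℝ → ℝ → ℝ)
    (hC : ∀ u v : ℝ, u ∈ Set.Ioc (0 : ℝ) 1 → v ∈ Set.Ioc (0 : ℝ) 1 →
      C u v = (((u ^ (-α) - 1) ^ β + (v ^ (-α) - 1) ^ β) ^ (1 / β) + 1)
        ^ (-(1 / α)))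
    (hC0 : ∀ u v : ℝ, u = 0 ∨ v = 0 → C u v = 0)
    (μ : Measure (ℝ × ℝ)) [IsProbabilityMeasure μ]
    (hcdf : ∀ u v : ℝ, u ∈ Set.Icc (0 : ℝ) 1 → v ∈ Set.Icc (0 : ℝ) 1 →
      μ (Set.Icc 0 u ×ˢ Set.Icc 0 v) = ENNReal.ofReal (C u v)) :
    (∫ p : ℝ × ℝ, C p.1 p.2 ∂μ) = (2 * β + α * β - 1) / (4 * β + 2 * α * β) ∧
      4 * (∫ p : ℝ × ℝ, C p.1 p.2 ∂μ) - 1 = 1 - 2 / (β * (α + 2)) := by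
  have hβ0 : 0 < β := by linarith
  have hC' : ∀ u ∈ Ioc (0 : ℝ) 1, ∀ v ∈ Ioc (0 : ℝ) 1, C u v =
      psi (1 / β) (1 / α) (gumbelGenerator α β u + gumbelGenerator α β v) :=
    fun u hu v hv => hC u v hu hv
  have h1 : (1 : ℝ) ∈ Ioc (0 : ℝ) 1 := ⟨one_pos, le_rfl⟩
  have hone : μ (Icc 0 1 ×ˢ Icc 0 1) = 1 := by
    have h : gumbelGenerator α β 1 = 0 := by simp [gumbelGenerator, Real.zero_rpow hβ0.ne']
    rw [hcdf 1 1 (right_mem_Icc.2 zero_le_one) (right_mem_Icc.2 zero_le_one), hC' 1 h1 1 h1, h,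
      add_zero, psi_zero (by positivity), ENNReal.ofReal_one]
  have hIcc : ∀ᵐ p ∂μ, p ∈ Icc (0 : ℝ) 1 ×ˢ Icc (0 : ℝ) 1 :=
    (prob_compl_eq_zero_iff (measurableSet_Icc.prod measurableSet_Icc)).2 hone
  have hleft : ∀ᵐ p ∂μ, p ∉ Icc (0 : ℝ) 0 ×ˢ Icc (0 : ℝ) 1 := by
    rw [← measure_eq_zero_iff_ae_notMem, hcdf 0 1 (left_mem_Icc.2 zero_le_one)
      (right_mem_Icc.2 zero_le_one), hC0 0 1 (Or.inl rfl), ENNReal.ofReal_zero]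
  have hright : ∀ᵐ p ∂μ, p ∉ Icc (0 : ℝ) 1 ×ˢ Icc (0 : ℝ) 0 := by
    rw [← measure_eq_zero_iff_ae_notMem, hcdf 1 0 (right_mem_Icc.2 zero_le_one)
      (left_mem_Icc.2 zero_le_one), hC0 1 0 (Or.inr rfl), ENNReal.ofReal_zero]
  have hmem : ∀ᵐ p ∂μ, p ∈ Ioc (0 : ℝ) 1 ×ˢ Ioc (0 : ℝ) 1 := by
    filter_upwards [hIcc, hleft, hright] with p hp hl hr
    exact ⟨⟨not_le.1 fun h => hl ⟨⟨hp.1.1, h⟩, hp.2⟩, hp.1.2⟩,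
      ⟨not_le.1 fun h => hr ⟨hp.1, ⟨hp.2.1, h⟩⟩, hp.2.2⟩⟩
  have hμ : μ = gumbelLaw α β := eq_gumbelLaw hα hβ hmem fun u hu v hv => by
    rw [hcdf u v (Ioc_subset_Icc_self hu) (Ioc_subset_Icc_self hv), hC' u hu v hv]
  have hint : ∫ p : ℝ × ℝ, C p.1 p.2 ∂μ = (2 * β + α * β - 1) / (4 * β + 2 * α * β) := by
    rw [← integral_gumbelLaw hα hβ, ← hμ]
    refine integral_congr_ae ?_
    filter_upwards [hmem] with p hp
    exact hC' _ hp.1 _ hp.2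
  refine ⟨hint, ?_⟩
  have : 4 * β + 2 * α * β ≠ 0 := by positivity
  rw [hint]
  field_simp
  ring
end

section
/- For every α > 0 and β ≥ 1, the copula moments of the transformed Gumbel family satisfy the identities: 1 − 2M₁(α,β) = 1/(β(α+2)), 1 − 3M₂(α,β) = 2/(β(α+3)), 1 − 4M₁(α,β) + 3M₂(α,β) = 2/(β(α+2)(α+3)), and 8M₁(α,β) − 9M₂(α,β) − 1 = 2α/(β(α+2)(α+3)); consequently (8M₁(α,β) − 9M₂(α,β) − 1)/(1 − 4M₁(α,β) + 3M₂(α,β)) = α and (1 − 4M₁(α,β) + 3M₂(α,β))/((1 − 2M₁(α,β))(1 − 3M₂(α,β))) = β, so (α,β) is the unique solution of the system M₁(α,β) = m₁, M₂(α,β) = m₂ when m₁ = M₁(α,β) and m₂ = M₂(α,β). -/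
theorem one_sub_two_mul_first_moment {a b : ℝ} (ha : 0 < a) (hb : 0 < b) :
    1 - 2 * ((2 * b + a * b - 1) / (4 * b + 2 * a * b)) = 1 / (b * (a + 2)) := by
  rw [show 4 * b + 2 * a * b = 2 * (b * (a + 2)) by ring]
  field_simp
  ring

theorem one_sub_three_mul_second_moment {a b : ℝ} (ha : 0 < a) (hb : 0 < b) :
    1 - 3 * ((3 * b + a * b - 2) / (9 * b + 3 * a * b)) = 2 / (b * (a + 3)) := by
  rw [show 9 * b + 3 * a * b = 3 * (b * (a + 3)) by ring]
  field_simp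
  ring

theorem moment_combinations {m₁ m₂ a b : ℝ} (ha : 0 < a) (hb : 0 < b)
    (h₁ : 1 - 2 * m₁ = 1 / (b * (a + 2))) (h₂ : 1 - 3 * m₂ = 2 / (b * (a + 3))) :
    1 - 4 * m₁ + 3 * m₂ = 2 / (b * (a + 2) * (a + 3)) ∧
    8 * m₁ - 9 * m₂ - 1 = 2 * a / (b * (a + 2) * (a + 3)) ∧
    (8 * m₁ - 9 * m₂ - 1) / (1 - 4 * m₁ + 3 * m₂) = a ∧
    (1 - 4 * m₁ + 3 * m₂) / ((1 - 2 * m₁) * (1 - 3 * m₂)) = b := by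
  have h₃ : 1 - 4 * m₁ + 3 * m₂ = 2 / (b * (a + 2) * (a + 3)) := by
    rw [show 1 - 4 * m₁ + 3 * m₂ = 2 * (1 - 2 * m₁) - (1 - 3 * m₂) by ring, h₁, h₂]
    field_simp
    ring
  have h₄ : 8 * m₁ - 9 * m₂ - 1 = 2 * a / (b * (a + 2) * (a + 3)) := by
    rw [show 8 * m₁ - 9 * m₂ - 1 = 3 * (1 - 3 * m₂) - 4 * (1 - 2 * m₁) by ring, h₁, h₂]
    field_simp
    ring
  refine ⟨h₃, h₄, ?_, ?_⟩
  · rw [h₃, h₄]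
    field_simp
  · rw [h₃, h₁, h₂]
    field_simp

/-- With `M₁(α,β) = (2β + αβ - 1)/(4β + 2αβ)` and
`M₂(α,β) = (3β + αβ - 2)/(9β + 3αβ)`, for every `α > 0` and `β ≥ 1` the stated
algebraic identities hold, and consequently `(α,β)` is recovered from
`(M₁(α,β), M₂(α,β))`, hence is the unique solution of the moment system. -/
theorem stmt_12 (M₁ M₂ : ℝ → ℝ → ℝ)
    (hM₁ : ∀ a b : ℝ, M₁ a b = (2 * b + a * b - 1) / (4 * b + 2 * a * b))
    (hM₂ : ∀ a b : ℝ, M₂ a b = (3 * b + a * b - 2) / (9 * b + 3 * a * b))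
    (α β : ℝ) (hα : 0 < α) (hβ : 1 ≤ β) :
    1 - 2 * M₁ α β = 1 / (β * (α + 2)) ∧
    1 - 3 * M₂ α β = 2 / (β * (α + 3)) ∧
    1 - 4 * M₁ α β + 3 * M₂ α β = 2 / (β * (α + 2) * (α + 3)) ∧
    8 * M₁ α β - 9 * M₂ α β - 1 = 2 * α / (β * (α + 2) * (α + 3)) ∧
    (8 * M₁ α β - 9 * M₂ α β - 1) / (1 - 4 * M₁ α β + 3 * M₂ α β) = α ∧
    (1 - 4 * M₁ α β + 3 * M₂ α β) /
        ((1 - 2 * M₁ α β) * (1 - 3 * M₂ α β)) = β ∧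
    ∀ a b : ℝ, 0 < a → 1 ≤ b →
      M₁ a b = M₁ α β → M₂ a b = M₂ α β → a = α ∧ b = β := by
  have h₁ : ∀ a b : ℝ, 0 < a → 1 ≤ b → 1 - 2 * M₁ a b = 1 / (b * (a + 2)) := by
    intro a b ha hb
    rw [hM₁, one_sub_two_mul_first_moment ha (by linarith)]
  have h₂ : ∀ a b : ℝ, 0 < a → 1 ≤ b → 1 - 3 * M₂ a b = 2 / (b * (a + 3)) := by
    intro a b ha hb
    rw [hM₂, one_sub_three_mul_second_moment ha (by linarith)]
  obtain ⟨h₃, h₄, h₅, h₆⟩ :=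
    moment_combinations hα (by linarith) (h₁ α β hα hβ) (h₂ α β hα hβ)
  refine ⟨h₁ α β hα hβ, h₂ α β hα hβ, h₃, h₄, h₅, h₆, ?_⟩
  intro a b ha hb e₁ e₂
  obtain ⟨-, -, ha', hb'⟩ :=
    moment_combinations ha (by linarith) (h₁ a b ha hb) (h₂ a b ha hb)
  rw [e₁, e₂] at ha' hb'
  exact ⟨ha'.symm.trans h₅, hb'.symm.trans h₆⟩
end

section
/- The map (α,β) ↦ (M₁(α,β), M₂(α,β)) is injective on (0,∞) × [1,∞): if α₁, α₂ > 0 and β₁, β₂ ≥ 1 satisfy M₁(α₁,β₁) = M₁(α₂,β₂) and M₂(α₁,β₁) = M₂(α₂,β₂), then α₁ = α₂ and β₁ = β₂. -/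
/-- The map `(α,β) ↦ (M₁(α,β), M₂(α,β))` with
`M₁(α,β) = (2β + αβ - 1)/(4β + 2αβ)` and `M₂(α,β) = (3β + αβ - 2)/(9β + 3αβ)`
is injective on `(0,∞) × [1,∞)`. -/
theorem stmt_13 (M₁ M₂ : ℝ → ℝ → ℝ)
    (hM₁ : ∀ a b : ℝ, M₁ a b = (2 * b + a * b - 1) / (4 * b + 2 * a * b))
    (hM₂ : ∀ a b : ℝ, M₂ a b = (3 * b + a * b - 2) / (9 * b + 3 * a * b))
    (α₁ α₂ β₁ β₂ : ℝ) (hα₁ : 0 < α₁) (hα₂ : 0 < α₂)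
    (hβ₁ : 1 ≤ β₁) (hβ₂ : 1 ≤ β₂)
    (h1 : M₁ α₁ β₁ = M₁ α₂ β₂) (h2 : M₂ α₁ β₁ = M₂ α₂ β₂) :
    α₁ = α₂ ∧ β₁ = β₂ := by
  have hb₁ : 0 < β₁ := by linarith
  have hb₂ : 0 < β₂ := by linarith
  rw [hM₁, hM₁, div_eq_div_iff (by positivity) (by positivity)] at h1
  rw [hM₂, hM₂, div_eq_div_iff (by positivity) (by positivity)] at h2
  have hβ : β₁ = β₂ := by linarith
  subst hβ
  exact ⟨mul_right_cancel₀ hb₁.ne' (by linarith), rfl⟩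
end

section
/- Let α₀ > 0 and β₀ ≥ 1, and let (m₁ₙ) and (m₂ₙ) be real sequences with m₁ₙ → M₁(α₀,β₀) and m₂ₙ → M₂(α₀,β₀). Then the copula-moment estimators α̂ₙ = (8m₁ₙ − 9m₂ₙ − 1)/(1 − 4m₁ₙ + 3m₂ₙ) and β̂ₙ = (1 − 4m₁ₙ + 3m₂ₙ)/((1 − 2m₁ₙ)(1 − 3m₂ₙ)) are well defined for all sufficiently large n and satisfy α̂ₙ → α₀ and β̂ₙ → β₀. -/
open Filter

/-- Let `α₀ > 0`, `β₀ ≥ 1` and let `m₁ₙ → M₁(α₀,β₀)`,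
`m₂ₙ → M₂(α₀,β₀)`, where `M₁(α,β) = (2β + αβ - 1)/(4β + 2αβ)` and
`M₂(α,β) = (3β + αβ - 2)/(9β + 3αβ)`. Then the copula-moment estimators
`α̂ₙ = (8m₁ₙ - 9m₂ₙ - 1)/(1 - 4m₁ₙ + 3m₂ₙ)` and
`β̂ₙ = (1 - 4m₁ₙ + 3m₂ₙ)/((1 - 2m₁ₙ)(1 - 3m₂ₙ))` are well defined (their
denominators are nonzero) for all sufficiently large `n`, and
`α̂ₙ → α₀`, `β̂ₙ → β₀`. -/
theorem stmt_15 (M₁ M₂ : ℝ → ℝ → ℝ)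
    (hM₁ : ∀ a b : ℝ, M₁ a b = (2 * b + a * b - 1) / (4 * b + 2 * a * b))
    (hM₂ : ∀ a b : ℝ, M₂ a b = (3 * b + a * b - 2) / (9 * b + 3 * a * b))
    (α₀ β₀ : ℝ) (hα₀ : 0 < α₀) (hβ₀ : 1 ≤ β₀)
    (m₁ m₂ : ℕ → ℝ)
    (hm₁ : Tendsto m₁ atTop (nhds (M₁ α₀ β₀)))
    (hm₂ : Tendsto m₂ atTop (nhds (M₂ α₀ β₀)))
    (αhat βhat : ℕ → ℝ)
    (hαhat : ∀ n, αhat n =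
      (8 * m₁ n - 9 * m₂ n - 1) / (1 - 4 * m₁ n + 3 * m₂ n))
    (hβhat : ∀ n, βhat n =
      (1 - 4 * m₁ n + 3 * m₂ n) / ((1 - 2 * m₁ n) * (1 - 3 * m₂ n))) :
    (∀ᶠ n in atTop, 1 - 4 * m₁ n + 3 * m₂ n ≠ 0 ∧
        1 - 2 * m₁ n ≠ 0 ∧ 1 - 3 * m₂ n ≠ 0) ∧
      Tendsto αhat atTop (nhds α₀) ∧ Tendsto βhat atTop (nhds β₀) := by
  have hβ : 0 < β₀ := by linarith
  have e₁ : 1 - 2 * M₁ α₀ β₀ = 1 / (β₀ * (2 + α₀)) := by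
    rw [hM₁, show 4 * β₀ + 2 * α₀ * β₀ = 2 * (β₀ * (2 + α₀)) by ring]
    field_simp
    ring
  have e₂ : 1 - 3 * M₂ α₀ β₀ = 2 / (β₀ * (3 + α₀)) := by
    rw [hM₂, show 9 * β₀ + 3 * α₀ * β₀ = 3 * (β₀ * (3 + α₀)) by ring]
    field_simp
    ring
  have e₃ : 1 - 4 * M₁ α₀ β₀ + 3 * M₂ α₀ β₀ = 2 / (β₀ * (2 + α₀) * (3 + α₀)) := by
    rw [show 1 - 4 * M₁ α₀ β₀ + 3 * M₂ α₀ β₀ =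
      2 * (1 - 2 * M₁ α₀ β₀) - (1 - 3 * M₂ α₀ β₀) by ring, e₁, e₂]
    field_simp
    ring
  have e₄ : 8 * M₁ α₀ β₀ - 9 * M₂ α₀ β₀ - 1 = 2 * α₀ / (β₀ * (2 + α₀) * (3 + α₀)) := by
    rw [show 8 * M₁ α₀ β₀ - 9 * M₂ α₀ β₀ - 1 =
      3 * (1 - 3 * M₂ α₀ β₀) - 4 * (1 - 2 * M₁ α₀ β₀) by ring, e₁, e₂]
    field_simp
    ring
  have t₁ : Tendsto (fun n => 1 - 2 * m₁ n) atTop (nhds (1 / (β₀ * (2 + α₀)))) :=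
    e₁ ▸ (hm₁.const_mul 2).const_sub 1
  have t₂ : Tendsto (fun n => 1 - 3 * m₂ n) atTop (nhds (2 / (β₀ * (3 + α₀)))) :=
    e₂ ▸ (hm₂.const_mul 3).const_sub 1
  have t₃ : Tendsto (fun n => 1 - 4 * m₁ n + 3 * m₂ n) atTop
      (nhds (2 / (β₀ * (2 + α₀) * (3 + α₀)))) :=
    e₃ ▸ ((hm₁.const_mul 4).const_sub 1).add (hm₂.const_mul 3)
  have t₄ : Tendsto (fun n => 8 * m₁ n - 9 * m₂ n - 1) atTop
      (nhds (2 * α₀ / (β₀ * (2 + α₀) * (3 + α₀)))) :=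
    e₄ ▸ ((hm₁.const_mul 8).sub (hm₂.const_mul 9)).sub_const 1
  have p₁ : 1 / (β₀ * (2 + α₀)) ≠ 0 := by positivity
  have p₂ : 2 / (β₀ * (3 + α₀)) ≠ 0 := by positivity
  have p₃ : 2 / (β₀ * (2 + α₀) * (3 + α₀)) ≠ 0 := by positivity
  refine ⟨(t₃.eventually_ne p₃).and ((t₁.eventually_ne p₁).and (t₂.eventually_ne p₂)), ?_, ?_⟩
  · have hα : 2 * α₀ / (β₀ * (2 + α₀) * (3 + α₀)) / (2 / (β₀ * (2 + α₀) * (3 + α₀))) = α₀ := by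
      field_simp
    rw [funext hαhat]
    have t := t₄.div t₃ p₃
    rwa [hα] at t
  · have hβ_eq : 2 / (β₀ * (2 + α₀) * (3 + α₀)) /
        (1 / (β₀ * (2 + α₀)) * (2 / (β₀ * (3 + α₀)))) = β₀ := by
      field_simp
    rw [funext hβhat]
    have t := t₃.div (t₁.mul t₂) (mul_ne_zero p₁ p₂)
    rwa [hβ_eq] at t
end
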